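/- arXiv:1802.10248 — 2 statements merged into one kernel-verified Lean document; each statement's English description precedes it below -/
import Mathlib

section
/- (Proposition 1, 2D case) Let g be a symmetric positive definite bilinear form on ℝ² with matrix entries g_ij = g(e_i, e_j) for the standard basis e₁, e₂, and let R : (ℝ²)⁴ → ℝ be a multilinear map with the curvature symmetries R(a,b,c,d) = −R(b,a,c,d) = −R(a,b,d,c) = R(c,d,a,b). Suppose θ ∈ ℝ and x, y ∈ ℝ² satisfy g(x,x) = g(y,y) = 1, R(a,y,x,y) = θ g(a,x) for all a ∈ ℝ², and R(a,x,y,x) = θ g(a,y) for all a ∈ ℝ². Then θ = 0 or θ = K, where K = R(e₁,e₂,e₁,e₂)/(g₁₁g₂₂ − g₁₂²) is the Gaussian curvature. If moreover g(x,y) = 0 (modified M-eigenproblem), then θ = K. -/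
/-- A skew-symmetric bilinear form on the plane is the determinant times its value on the
standard basis. -/
lemma skew_bilin_eq_det_mul (B : (Fin 2 → ℝ) →ₗ[ℝ] (Fin 2 → ℝ) →ₗ[ℝ] ℝ)
    (hB : ∀ x y, B x y = -B y x) (x y : Fin 2 → ℝ) :
    B x y = (x 0 * y 1 - x 1 * y 0) * B (Pi.single 0 1) (Pi.single 1 1) := by
  have h0 := hB (Pi.single 0 1) (Pi.single 0 1)
  have h1 := hB (Pi.single 1 1) (Pi.single 1 1)
  have h01 := hB (Pi.single 1 1) (Pi.single 0 1)
  conv_lhs => rw [pi_eq_sum_univ' x, pi_eq_sum_univ' y]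
  simp only [Fin.sum_univ_two, map_add, map_smul, LinearMap.add_apply, LinearMap.smul_apply,
    smul_eq_mul]
  linear_combination x 0 * y 0 / 2 * h0 + x 1 * y 1 / 2 * h1 + x 1 * y 0 * h01

/-- The Gram determinant of two vectors of the plane in terms of that of the standard basis. -/
lemma gram_det_eq (g : (Fin 2 → ℝ) →ₗ[ℝ] (Fin 2 → ℝ) →ₗ[ℝ] ℝ)
    (hg : ∀ x y, g x y = g y x) (x y : Fin 2 → ℝ) :
    g x x * g y y - g x y ^ 2 = (x 0 * y 1 - x 1 * y 0) ^ 2 *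
      (g (Pi.single 0 1) (Pi.single 0 1) * g (Pi.single 1 1) (Pi.single 1 1) -
        g (Pi.single 0 1) (Pi.single 1 1) ^ 2) := by
  have h01 := hg (Pi.single 1 1) (Pi.single 0 1)
  conv_lhs => rw [pi_eq_sum_univ' x, pi_eq_sum_univ' y]
  simp only [Fin.sum_univ_two, map_add, map_smul, LinearMap.add_apply, LinearMap.smul_apply,
    smul_eq_mul, h01]
  ring


/-- Proposition 1, 2D case: For a curvature-type tensor R on ℝ² relative to
a symmetric positive definite bilinear form g, every M-eigenvalue θ is 0 or the Gaussian
curvature K = R(e₁,e₂,e₁,e₂)/(g₁₁g₂₂ − g₁₂²); for the modified M-eigenproblem, θ = K. -/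
theorem twoD_mEigenvalues
    (g : (Fin 2 → ℝ) →ₗ[ℝ] (Fin 2 → ℝ) →ₗ[ℝ] ℝ)
    (hg_symm : ∀ x y : Fin 2 → ℝ, g x y = g y x)
    (hg_pd : ∀ x : Fin 2 → ℝ, x ≠ 0 → 0 < g x x)
    (R : (Fin 2 → ℝ) →ₗ[ℝ] (Fin 2 → ℝ) →ₗ[ℝ] (Fin 2 → ℝ) →ₗ[ℝ] (Fin 2 → ℝ) →ₗ[ℝ] ℝ)
    (hsym1 : ∀ a b c d : Fin 2 → ℝ, R a b c d = - R b a c d)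
    (hsym2 : ∀ a b c d : Fin 2 → ℝ, R a b c d = - R a b d c)
    (hsym3 : ∀ a b c d : Fin 2 → ℝ, R a b c d = R c d a b)
    (θ : ℝ) (x y : Fin 2 → ℝ)
    (hx : g x x = 1) (hy : g y y = 1)
    (h1 : ∀ a : Fin 2 → ℝ, R a y x y = θ * g a x)
    (h2 : ∀ a : Fin 2 → ℝ, R a x y x = θ * g a y) :
    let e : Fin 2 → (Fin 2 → ℝ) := fun i => Pi.single i 1
    let K : ℝ := R (e 0) (e 1) (e 0) (e 1) /
      (g (e 0) (e 0) * g (e 1) (e 1) - (g (e 0) (e 1)) ^ 2)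
    (θ = 0 ∨ θ = K) ∧ (g x y = 0 → θ = K) := by
  intro e K
  have hR : R x y x y = (x 0 * y 1 - x 1 * y 0) ^ 2 * R (e 0) (e 1) (e 0) (e 1) := by
    have hcd := skew_bilin_eq_det_mul (R x y) (hsym2 x y) x y
    have hab : R x y (e 0) (e 1) =
        (x 0 * y 1 - x 1 * y 0) * R (e 0) (e 1) (e 0) (e 1) := by
      rw [hsym3 x y]
      exact skew_bilin_eq_det_mul (R (e 0) (e 1)) (hsym2 (e 0) (e 1)) x y
    rw [hcd]
    linear_combination (x 0 * y 1 - x 1 * y 0) * hab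
  have hθ : R x y x y = θ := by rw [h1, hx, mul_one]
  have hθc : θ * g x y = 0 := by
    have h := hsym1 y y x y
    rw [h1, hg_symm y x] at h
    linarith
  have hK : g x y = 0 → θ = K := by
    intro hc
    have hD := gram_det_eq g hg_symm x y
    rw [hx, hy, hc] at hD
    have hD0 : g (e 0) (e 0) * g (e 1) (e 1) - g (e 0) (e 1) ^ 2 ≠ 0 := by
      intro h
      simp only [e] at h
      rw [h] at hD
      norm_num at hD
    simp only [K]
    rw [eq_div_iff hD0, ← hθ, hR]
    simp only [e]
    linear_combination -R (Pi.single 0 1) (Pi.single 1 1) (Pi.single 0 1) (Pi.single 1 1) * hD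
  exact ⟨(mul_eq_zero.mp hθc).imp_right hK, hK⟩
end

section
/- (Proposition 4, Schwarzschild) Let G, M, c, r, θ₀ be real numbers with G, M, c > 0, r_s = 2GM/c², r > r_s, and sin θ₀ ≠ 0. Set f = 1 − r_s/r, A = r_s c² f/(2r³), B = r_s/(2r³ f), C = r_s/(2r), D = C sin²θ₀, and ζ = −r_s/(2r³). Then there exist x = (x⁰,x¹,x²,x³) and y = (y⁰,y¹,y²,y³) in ℝ⁴ satisfying the normalization constraints −c²f (x⁰)² + (x¹)²/f + r²(x²)² + r² sin²θ₀ (x³)² = 1 and −c²f (y⁰)² + (y¹)²/f + r²(y²)² + r² sin²θ₀ (y³)² = 1, together with the eight polynomial equations: 2B y¹(x⁰y¹−x¹y⁰) − C y²(x⁰y²−x²y⁰) − D y³(x⁰y³−x³y⁰) = ζx⁰; 2A y⁰(x⁰y¹−x¹y⁰) − C y²(x¹y²−x²y¹) − D y³(x¹y³−x³y¹) = ζx¹; −A y⁰(x⁰y²−x²y⁰) + B y¹(x¹y²−x²y¹) + 2D y³(x²y³−x³y²) = ζx²; −A y⁰(x⁰y³−x³y⁰) + B y¹(x¹y³−x³y¹)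 − 2C y²(x²y³−x³y²) = ζx³; −2B x¹(x⁰y¹−x¹y⁰) + C x²(x⁰y²−x²y⁰) + D x³(x⁰y³−x³y⁰) = ζy⁰; −2A x⁰(x⁰y¹−x¹y⁰) + C x²(x¹y²−x²y¹) + D x³(x¹y³−x³y¹) = ζy¹; A x⁰(x⁰y²−x²y⁰) − B x¹(x¹y²−x²y¹) − 2D x³(x²y³−x³y²) = ζy²; A x⁰(x⁰y³−x³y⁰) − B x¹(x¹y³−x³y¹) + 2C x²(x²y³−x³y²) = ζy³. Moreover ζ = −GM/(c²r³) = −√(K₁/48), where K₁ = 48G²M²/(c⁴r⁶) is the Kretschmann invariant. -/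
/-- Proposition 4, Schwarzschild: The M-eigenproblem of the Riemann
curvature tensor of the Schwarzschild solution has a solution (x, y) satisfying the
normalization constraints and the eight polynomial equations, with M-eigenvalue
ζ = −r_s/(2r³) = −GM/(c²r³) = −√(K₁/48), where K₁ = 48G²M²/(c⁴r⁶) is the Kretschmann
invariant. -/
theorem schwarzschild_mEigenvalue
    (G M c r θ₀ : ℝ) (hG : 0 < G) (hM : 0 < M) (hc : 0 < c)
    (hr : 2 * G * M / c ^ 2 < r) (hsin : Real.sin θ₀ ≠ 0) :
    let rs : ℝ := 2 * G * M / c ^ 2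
    let f : ℝ := 1 - rs / r
    let A : ℝ := rs * c ^ 2 * f / (2 * r ^ 3)
    let B : ℝ := rs / (2 * r ^ 3 * f)
    let C : ℝ := rs / (2 * r)
    let D : ℝ := C * Real.sin θ₀ ^ 2
    let ζ : ℝ := -rs / (2 * r ^ 3)
    let K₁ : ℝ := 48 * G ^ 2 * M ^ 2 / (c ^ 4 * r ^ 6)
    (∃ x0 x1 x2 x3 y0 y1 y2 y3 : ℝ,
      (-(c ^ 2 * f) * x0 ^ 2 + x1 ^ 2 / f + r ^ 2 * x2 ^ 2
          + r ^ 2 * Real.sin θ₀ ^ 2 * x3 ^ 2 = 1) ∧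
      (-(c ^ 2 * f) * y0 ^ 2 + y1 ^ 2 / f + r ^ 2 * y2 ^ 2
          + r ^ 2 * Real.sin θ₀ ^ 2 * y3 ^ 2 = 1) ∧
      (2 * B * y1 * (x0 * y1 - x1 * y0) - C * y2 * (x0 * y2 - x2 * y0)
          - D * y3 * (x0 * y3 - x3 * y0) = ζ * x0) ∧
      (2 * A * y0 * (x0 * y1 - x1 * y0) - C * y2 * (x1 * y2 - x2 * y1)
          - D * y3 * (x1 * y3 - x3 * y1) = ζ * x1) ∧
      (-(A * y0) * (x0 * y2 - x2 * y0) + B * y1 * (x1 * y2 - x2 * y1)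
          + 2 * D * y3 * (x2 * y3 - x3 * y2) = ζ * x2) ∧
      (-(A * y0) * (x0 * y3 - x3 * y0) + B * y1 * (x1 * y3 - x3 * y1)
          - 2 * C * y2 * (x2 * y3 - x3 * y2) = ζ * x3) ∧
      (-(2 * B * x1) * (x0 * y1 - x1 * y0) + C * x2 * (x0 * y2 - x2 * y0)
          + D * x3 * (x0 * y3 - x3 * y0) = ζ * y0) ∧
      (-(2 * A * x0) * (x0 * y1 - x1 * y0) + C * x2 * (x1 * y2 - x2 * y1)
          + D * x3 * (x1 * y3 - x3 * y1) = ζ * y1) ∧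
      (A * x0 * (x0 * y2 - x2 * y0) - B * x1 * (x1 * y2 - x2 * y1)
          - 2 * D * x3 * (x2 * y3 - x3 * y2) = ζ * y2) ∧
      (A * x0 * (x0 * y3 - x3 * y0) - B * x1 * (x1 * y3 - x3 * y1)
          + 2 * C * x2 * (x2 * y3 - x3 * y2) = ζ * y3)) ∧
    ζ = -(G * M) / (c ^ 2 * r ^ 3) ∧
    ζ = -Real.sqrt (K₁ / 48) := by
  intro rs f A B C D ζ K₁
  have hrs : 0 < rs := by positivity
  have hr0 : 0 < r := hrs.trans hr
  have hf : 0 < f := sub_pos.mpr ((div_lt_one hr0).mpr hr)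
  have hsq : √f ^ 2 = f := Real.sq_sqrt hf.le
  have hζ : ζ = -(G * M) / (c ^ 2 * r ^ 3) := by
    simp only [ζ, rs]
    field_simp
  refine ⟨⟨0, √f, 0, 0, 0, 0, 1 / r, 0, ?_, ?_, ?_, ?_, ?_, ?_, ?_, ?_, ?_, ?_⟩, hζ, ?_⟩
  · simp [hsq, hf.ne']
  · field_simp
    ring
  · simp
  · simp only [C, D, ζ]
    field_simp
    ring
  · simp
  · simp
  · simp
  · simp
  · have hBf : B * f = -ζ := by
      simp only [B, ζ]
      field_simp
    linear_combination (-B / r) * hsq - (1 / r) * hBf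
  · simp
  · have hK : K₁ / 48 = (G * M / (c ^ 2 * r ^ 3)) ^ 2 := by
      simp only [K₁]
      field_simp
    rw [hζ, hK, Real.sqrt_sq (by positivity), neg_div]
end
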